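/- arXiv:2304.02000 — 5 statements merged into one kernel-verified Lean document; each statement's English description precedes it below -/
import Mathlib

section
/- Let p, q ≥ 1, n = p+q, Z = diag(q,…,q,−p,…,−p) (q repeated p times, −p repeated q times). Let λ = (λ(1) ≥ … ≥ λ(n)) be a weakly decreasing real sequence. Then for every t ∈ ℝ, the set { g D_λ g^{-1} : g ∈ U(p,q), Re tr(g D_λ g^{-1} Z) = t } is a compact subset of the space of n×n complex matrices. -/
open Matrix

noncomputable section

/-- The standard flag subspace `span(e_1, …, e_j)` of `ℂ^n` (with 0-indexed coordinates,
this is the space of vectors vanishing on all coordinates `≥ j`). -/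
def stdFlag (n j : ℕ) : Submodule ℂ (Fin n → ℂ) where
  carrier := {f | ∀ i : Fin n, j ≤ (i : ℕ) → f i = 0}
  add_mem' := by
    intro a b ha hb i hi
    simp only [Pi.add_apply, ha i hi, hb i hi, add_zero]
  zero_mem' := by intro i _; rfl
  smul_mem' := by
    intro c f hf i hi
    simp only [Pi.smul_apply, hf i hi, smul_zero]

/-- A quiver given by source and target maps has no oriented cycles. -/
def NoCycles {V A : Type} (src tgt : A → V) : Prop :=
  ∀ (k : ℕ) (f : Fin (k + 1) → A),
    (∀ i : Fin k, tgt (f i.castSucc) = src (f i.succ)) →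
    tgt (f (Fin.last k)) ≠ src (f 0)

/-- `α ≤_Q n` : every representation of the quiver on the spaces `ℂ^{n_x}` has a
subrepresentation of dimension vector `α`. -/
def HasSubrepOfDim {V A : Type} (src tgt : A → V) (n : V → ℕ) (α : V → ℕ) : Prop :=
  ∀ r : ∀ a : A, (Fin (n (src a)) → ℂ) →ₗ[ℂ] (Fin (n (tgt a)) → ℂ),
    ∃ S : ∀ x : V, Submodule ℂ (Fin (n x) → ℂ),
      (∀ x : V, Module.finrank ℂ (S x) = α x) ∧
      (∀ a : A, (S (src a)).map (r a) ≤ S (tgt a))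

/-- A family `K = (K_x)` of subsets `K_x ⊆ {1,…,n_x}` is `Q`-intersecting for `n` if every
representation of the quiver on the `ℂ^{n_x}` admits a subrepresentation `S` lying in the
Schubert variety indexed by `K` (w.r.t. the standard flags). -/
def IsQIntersecting {V A : Type} (src tgt : A → V) (n : V → ℕ)
    (K : ∀ x : V, Finset (Fin (n x))) : Prop :=
  ∀ r : ∀ a : A, (Fin (n (src a)) → ℂ) →ₗ[ℂ] (Fin (n (tgt a)) → ℂ),
    ∃ S : ∀ x : V, Submodule ℂ (Fin (n x) → ℂ),
      (∀ x : V, Module.finrank ℂ (S x) = (K x).card) ∧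
      (∀ x : V, ∀ j : Fin (K x).card,
        (j : ℕ) + 1 ≤ Module.finrank ℂ
          ((S x ⊓ stdFlag (n x) ((((K x).orderIsoOfFin rfl j : Fin (n x)) : ℕ) + 1) :
            Submodule ℂ (Fin (n x) → ℂ)))) ∧
      (∀ a : A, (S (src a)).map (r a) ≤ S (tgt a))

/-- The expected dimension `edim_{Q,B}(K, n)`. -/
def edimQB {V A : Type} [Fintype V] [Fintype A] (src tgt : A → V) (n : V → ℕ)
    (K : ∀ x : V, Finset (Fin (n x))) : ℤ :=
  (∑ x : V, ∑ j : Fin (K x).card,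
      (((((K x).orderIsoOfFin rfl j : Fin (n x)) : ℕ) : ℤ) - ((j : ℕ) : ℤ))) -
  ∑ a : A, ((K (src a)).card : ℤ) * ((n (tgt a) : ℤ) - ((K (tgt a)).card : ℤ))

/-- Composition `K ∘ L` of a family of subsets with a family of subsets of the index sets. -/
def composeFam {V : Type} {n : V → ℕ} (K : ∀ x : V, Finset (Fin (n x)))
    (L : ∀ x : V, Finset (Fin (K x).card)) : ∀ x : V, Finset (Fin (n x)) :=
  fun x => (L x).image (fun j => ((K x).orderIsoOfFin rfl j : Fin (n x)))

/-- The moment map for the action of `∏_x U(n_x)` on the representation space of the quiver,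
`μ_x(r) = Σ_{b : y→x} r_b r_b^* − Σ_{a : x→y} r_a^* r_a`. -/
def momentMap {V A : Type} [Fintype A] [DecidableEq V] (src tgt : A → V) (n : V → ℕ)
    (r : ∀ a : A, Matrix (Fin (n (tgt a))) (Fin (n (src a))) ℂ) (x : V) :
    Matrix (Fin (n x)) (Fin (n x)) ℂ :=
  (∑ a : A, if h : tgt a = x then
      Matrix.reindex (finCongr (congrArg n h)) (finCongr (congrArg n h)) (r a * (r a)ᴴ)
    else 0) -
  (∑ a : A, if h : src a = x then
      Matrix.reindex (finCongr (congrArg n h)) (finCongr (congrArg n h)) ((r a)ᴴ * r a)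
    else 0)

/-! ### The quiver `Q_{3,3}` with vertices `1,…,6` and arrows `1→3, 2→3, 4→3, 4→5, 4→6`
(0-indexed: `0→2, 1→2, 3→2, 3→4, 3→5`). -/

def q33src : Fin 5 → Fin 6 := ![0, 1, 3, 3, 3]

def q33tgt : Fin 5 → Fin 6 := ![2, 2, 2, 4, 5]

/-- The dimension vector `[p,p,p,q,q,q]` for `Q_{3,3}`. -/
def n33 (p q : ℕ) : Fin 6 → ℕ
  | ⟨0, _⟩ => p
  | ⟨1, _⟩ => p
  | ⟨2, _⟩ => p
  | ⟨3, _⟩ => q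
  | ⟨4, _⟩ => q
  | ⟨5, _⟩ => q

/-- A family of subsets for `Q_{3,3}` built from three subsets of `{1,…,p}` (vertices 1,2,3)
and three subsets of `{1,…,q}` (vertices 4,5,6). -/
def fam6 (p q : ℕ) (K : Fin 3 → Finset (Fin p)) (L : Fin 3 → Finset (Fin q)) :
    ∀ x : Fin 6, Finset (Fin (n33 p q x))
  | ⟨0, _⟩ => K 0
  | ⟨1, _⟩ => K 1
  | ⟨2, _⟩ => K 2
  | ⟨3, _⟩ => L 0
  | ⟨4, _⟩ => L 1
  | ⟨5, _⟩ => L 2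

/-! ### The pseudo-unitary group `U(p,q)` -/

/-- The matrix `η = diag(I_p, −I_q)`. -/
def etaMat (p q : ℕ) : Matrix (Fin (p + q)) (Fin (p + q)) ℂ :=
  Matrix.diagonal fun i => if (i : ℕ) < p then 1 else -1

/-- Membership in `U(p,q) = {g : gᴴ η g = η}`. -/
def InUpq (p q : ℕ) (g : Matrix (Fin (p + q)) (Fin (p + q)) ℂ) : Prop :=
  gᴴ * etaMat p q * g = etaMat p q

/-- The central element `Z = diag(q I_p, −p I_q)`. -/
def Zmat (p q : ℕ) : Matrix (Fin (p + q)) (Fin (p + q)) ℂ :=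
  Matrix.diagonal fun i => if (i : ℕ) < p then (q : ℂ) else -(p : ℂ)

/-- The complex diagonal matrix with entries a real sequence. -/
def Dmat {n : ℕ} (A : Fin n → ℝ) : Matrix (Fin n) (Fin n) ℂ :=
  Matrix.diagonal fun i => (A i : ℂ)

/-- The block-diagonal matrix `u ⊕ v`. -/
def blockDiag {p q : ℕ} (u : Matrix (Fin p) (Fin p) ℂ) (v : Matrix (Fin q) (Fin q) ℂ) :
    Matrix (Fin (p + q)) (Fin (p + q)) ℂ :=
  Matrix.reindex finSumFinEquiv finSumFinEquiv (Matrix.fromBlocks u 0 0 v)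

end

section Isometry

variable {V : Type*} [AddCommGroup V] [Module ℂ V]

/-- The quasi-reflection `x ↦ x - B(w, x) / c • w` preserves a Hermitian form as soon as
`c + conj c = B(w, w)`. -/
theorem quasiReflection_isometry (B : V →ₗ⋆[ℂ] V →ₗ[ℂ] ℂ)
    (hB : ∀ x y, star (B x y) = B y x) (w : V) (c : ℂ) (hc : c ≠ 0)
    (hcw : c + star c = B w w) :
    ∃ S : V →ₗ[ℂ] V, (∀ x y, B (S x) (S y) = B x y) ∧ ∀ x, S x = x - (c⁻¹ * B w x) • w := by
  refine ⟨LinearMap.id - (c⁻¹ • B w).smulRight w, ?_, fun x => by simp⟩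
  intro x y
  have hc' : star c ≠ 0 := star_ne_zero.mpr hc
  have hx : starRingEnd ℂ (B w x) = B x w := hB w x
  have e : starRingEnd ℂ c = star c := rfl
  simp only [LinearMap.sub_apply, LinearMap.id_apply, LinearMap.smulRight_apply,
    LinearMap.smul_apply, smul_eq_mul, map_sub, LinearMap.map_smulₛₗ, map_mul, map_inv₀, hx, e,
    ← hcw, RingHom.id_apply]
  field_simp
  ring

/-- Two vectors of equal nonzero length are related by an isometry fixing everything orthogonal
to both of them. -/
theorem exists_isometry_map_eq (B : V →ₗ⋆[ℂ] V →ₗ[ℂ] ℂ)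
    (hB : ∀ x y, star (B x y) = B y x) (x y : V) (hxy : B x x = B y y) (hy : B y y ≠ 0) :
    ∃ S : V →ₗ[ℂ] V, (∀ a b, B (S a) (S b) = B a b) ∧ S x = y ∧
      ∀ z, B x z = 0 → B y z = 0 → S z = z := by
  by_cases h : B y x = B y y
  · have hne : B x x + B y x ≠ 0 := by
      rw [h, hxy, ← two_mul]
      exact mul_ne_zero two_ne_zero hy
    obtain ⟨S, hS, hS'⟩ := quasiReflection_isometry B hB (x + y) (B x x + B y x) hne (by
      simp only [star_add, hB, map_add, LinearMap.add_apply, hxy]; ring)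
    obtain ⟨R, hR, hR'⟩ := quasiReflection_isometry B hB y (B y y / 2)
      (div_ne_zero hy two_ne_zero) (by
        have h2 : star (2 : ℂ) = 2 := by simp
        rw [star_div₀, hB, h2]; ring)
    have hSx : S x = -y := by
      rw [hS']
      simp only [map_add, LinearMap.add_apply]
      rw [inv_mul_cancel₀ hne, one_smul]; abel
    refine ⟨R ∘ₗ S, fun a b => by simp [hR, hS], ?_, fun z hz hz' => ?_⟩
    · rw [LinearMap.comp_apply, hSx, map_neg, hR', inv_div, div_mul_cancel₀ _ hy, two_smul]
      abel
    · rw [LinearMap.comp_apply, hS', hR']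
      simp [hz, hz']
  · have hne : B x x - B y x ≠ 0 := by
      rw [hxy]; exact sub_ne_zero.mpr (Ne.symm h)
    obtain ⟨S, hS, hS'⟩ := quasiReflection_isometry B hB (x - y) (B x x - B y x) hne (by
      simp only [star_sub, hB, map_sub, LinearMap.sub_apply, hxy]; ring)
    refine ⟨S, hS, ?_, fun z hz hz' => ?_⟩
    · rw [hS']
      simp only [map_sub, LinearMap.sub_apply]
      rw [inv_mul_cancel₀ hne, one_smul]; abel
    · rw [hS']
      simp [hz, hz']

/-- Witt extension for orthogonal families of anisotropic vectors. -/
theorem exists_isometry_of_orthogonal {ι : Type*} (B : V →ₗ⋆[ℂ] V →ₗ[ℂ] ℂ)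
    (hB : ∀ x y, star (B x y) = B y x) (u v : ι → V) (s : Finset ι)
    (hu : ∀ i ∈ s, ∀ j ∈ s, i ≠ j → B (u i) (u j) = 0)
    (hv : ∀ i ∈ s, ∀ j ∈ s, i ≠ j → B (v i) (v j) = 0)
    (huv : ∀ i ∈ s, B (u i) (u i) = B (v i) (v i)) (hne : ∀ i ∈ s, B (v i) (v i) ≠ 0) :
    ∃ T : V →ₗ[ℂ] V, (∀ a b, B (T a) (T b) = B a b) ∧ ∀ i ∈ s, T (u i) = v i := by
  classical
  induction s using Finset.induction_on with
  | empty => exact ⟨LinearMap.id, by simp, by simp⟩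
  | insert j s hj ih =>
    obtain ⟨T, hT, hTu⟩ := ih
      (fun i hi k hk => hu i (Finset.mem_insert_of_mem hi) k (Finset.mem_insert_of_mem hk))
      (fun i hi k hk => hv i (Finset.mem_insert_of_mem hi) k (Finset.mem_insert_of_mem hk))
      (fun i hi => huv i (Finset.mem_insert_of_mem hi))
      (fun i hi => hne i (Finset.mem_insert_of_mem hi))
    have hjs := Finset.mem_insert_self j s
    obtain ⟨S, hS, hSx, hSz⟩ := exists_isometry_map_eq B hB (T (u j)) (v j)
      (by rw [hT, huv j hjs]) (hne j hjs)
    refine ⟨S ∘ₗ T, fun a b => by simp [hS, hT], fun i hi => ?_⟩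
    rcases Finset.mem_insert.mp hi with rfl | hi'
    · exact hSx
    · have hji : j ≠ i := fun h => hj (h ▸ hi')
      rw [LinearMap.comp_apply, hTu i hi']
      refine hSz _ ?_ (hv j hjs i hi hji)
      rw [← hTu i hi', hT, hu j hjs i hi hji]

end Isometry

/-- The diagonal entries of `η`. -/
def etaSign (p q : ℕ) (i : Fin (p + q)) : ℝ := if (i : ℕ) < p then 1 else -1

theorem etaSign_mul_self (p q : ℕ) (i : Fin (p + q)) : etaSign p q i * etaSign p q i = 1 := by
  unfold etaSign; split_ifs <;> norm_num

theorem etaMat_eq (p q : ℕ) : etaMat p q = Matrix.diagonal fun i => (etaSign p q i : ℂ) := by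
  unfold etaMat etaSign
  congr 1; ext i; split_ifs <;> simp

theorem etaMat_mul_self (p q : ℕ) : etaMat p q * etaMat p q = 1 := by
  rw [etaMat_eq, Matrix.diagonal_mul_diagonal, ← Matrix.diagonal_one]
  congr 1; ext i
  exact_mod_cast etaSign_mul_self p q i

theorem InUpq.inv_eq {p q : ℕ} {g : Matrix (Fin (p + q)) (Fin (p + q)) ℂ} (hg : InUpq p q g) :
    g⁻¹ = etaMat p q * gᴴ * etaMat p q := by
  refine Matrix.inv_eq_left_inv ?_
  unfold InUpq at hg
  rw [mul_assoc (etaMat p q), mul_assoc, hg, etaMat_mul_self]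

theorem InUpq.mul_inv {p q : ℕ} {g : Matrix (Fin (p + q)) (Fin (p + q)) ℂ} (hg : InUpq p q g) :
    g * g⁻¹ = 1 := by
  rw [hg.inv_eq]
  refine mul_eq_one_comm.mp ?_
  unfold InUpq at hg
  rw [mul_assoc (etaMat p q), mul_assoc, hg, etaMat_mul_self]

/-- The Hermitian form with matrix `η`. -/
def etaForm (p q : ℕ) :
    (Fin (p + q) → ℂ) →ₗ⋆[ℂ] (Fin (p + q) → ℂ) →ₗ[ℂ] ℂ :=
  LinearMap.mk₂'ₛₗ (starRingEnd ℂ) (RingHom.id ℂ)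
    (fun x y => ∑ i, star (x i) * (etaSign p q i : ℂ) * y i)
    (fun x y z => by simp [add_mul, Finset.sum_add_distrib])
    (fun c x y => by simp [Finset.mul_sum, mul_assoc])
    (fun x y z => by simp [mul_add, Finset.sum_add_distrib])
    (fun c x y => by
      simp only [Pi.smul_apply, smul_eq_mul, Finset.mul_sum, RingHom.id_apply]
      exact Finset.sum_congr rfl fun i _ => by ring)

theorem etaForm_apply (p q : ℕ) (x y : Fin (p + q) → ℂ) :
    etaForm p q x y = ∑ i, star (x i) * (etaSign p q i : ℂ) * y i := rfl

theorem star_etaForm (p q : ℕ) (x y : Fin (p + q) → ℂ) :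
    star (etaForm p q x y) = etaForm p q y x := by
  simp only [etaForm_apply, star_sum, star_mul', star_star]
  refine Finset.sum_congr rfl fun i _ => ?_
  have : star (etaSign p q i : ℂ) = etaSign p q i := Complex.conj_ofReal _
  rw [this]; ring

theorem conjTranspose_mul_etaMat_mul_apply {p q : ℕ}
    (X : Matrix (Fin (p + q)) (Fin (p + q)) ℂ) (i j : Fin (p + q)) :
    (Xᴴ * etaMat p q * X) i j = etaForm p q (X.col i) (X.col j) := by
  rw [etaMat_eq, Matrix.mul_apply, etaForm_apply]
  simp [Matrix.mul_diagonal]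

/-- A matrix whose columns are `η`-orthogonal with Gram matrix `η · s²`, and vanish where `s`
does, is of the form `g · s` with `g ∈ U(p,q)`. -/
theorem exists_inUpq_mul_diagonal {p q : ℕ} (s : Fin (p + q) → ℝ)
    (X : Matrix (Fin (p + q)) (Fin (p + q)) ℂ)
    (hX : Xᴴ * etaMat p q * X =
      Matrix.diagonal fun i => ((etaSign p q i * (s i * s i) : ℝ) : ℂ))
    (hX0 : ∀ i j, s j = 0 → X i j = 0) :
    ∃ g, InUpq p q g ∧ X = g * Matrix.diagonal fun i => (s i : ℂ) := by
  have hgram : ∀ i j, etaForm p q (X.col i) (X.col j) =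
      Matrix.diagonal (fun i => ((etaSign p q i * (s i * s i) : ℝ) : ℂ)) i j := by
    intro i j
    rw [← conjTranspose_mul_etaMat_mul_apply, hX]
  have hstd : ∀ i j, etaForm p q (Pi.single i 1) (Pi.single j 1) = etaMat p q i j := by
    intro i j
    have := conjTranspose_mul_etaMat_mul_apply (p := p) (q := q) 1 i j
    rw [Matrix.conjTranspose_one, one_mul, mul_one] at this
    have hone : ∀ k : Fin (p + q), (1 : Matrix _ _ ℂ).col k = Pi.single k 1 := fun k => by
      ext l
      simp [Matrix.one_apply, Pi.single_apply]
    rw [this, hone, hone]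
  have hsign : ∀ i, (etaSign p q i : ℂ) ≠ 0 := fun i h => by
    have h1 := etaSign_mul_self p q i
    rw [Complex.ofReal_eq_zero.mp h] at h1
    norm_num at h1
  have hlen : ∀ i, s i ≠ 0 → etaForm p q ((s i : ℂ)⁻¹ • X.col i) ((s i : ℂ)⁻¹ • X.col i) =
      etaSign p q i := by
    intro i hi
    have hi' : (s i : ℂ) ≠ 0 := Complex.ofReal_ne_zero.mpr hi
    simp only [map_smul, LinearMap.map_smulₛₗ₂, hgram, Matrix.diagonal_apply_eq, smul_eq_mul,
      map_inv₀, Complex.conj_ofReal]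
    push_cast
    field_simp
  obtain ⟨T, hT, hTs⟩ := exists_isometry_of_orthogonal (etaForm p q) (star_etaForm p q)
    (fun i => Pi.single i (1 : ℂ)) (fun i => (s i : ℂ)⁻¹ • X.col i)
    (Finset.univ.filter fun i => s i ≠ 0)
    (fun i _ j _ hij => by rw [hstd, etaMat_eq, Matrix.diagonal_apply_ne _ hij])
    (fun i _ j _ hij => by
      simp only [map_smul, LinearMap.map_smulₛₗ₂, hgram, Matrix.diagonal_apply_ne _ hij,
        smul_zero])
    (fun i hi => by
      rw [hstd, etaMat_eq, Matrix.diagonal_apply_eq, hlen i (Finset.mem_filter.mp hi).2])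
    (fun i hi => by rw [hlen i (Finset.mem_filter.mp hi).2]; exact hsign i)
  have hcol : ∀ i, (LinearMap.toMatrix' T).col i = T (Pi.single i 1) := by
    intro i
    ext k
    simp [LinearMap.toMatrix'_apply]
  refine ⟨LinearMap.toMatrix' T, ?_, ?_⟩
  · ext i j
    rw [conjTranspose_mul_etaMat_mul_apply, hcol, hcol, hT, hstd]
  · ext i j
    rw [Matrix.mul_diagonal]
    by_cases hj : s j = 0
    · rw [hX0 i j hj, hj, Complex.ofReal_zero, mul_zero]
    · have hj' : (s j : ℂ) ≠ 0 := Complex.ofReal_ne_zero.mpr hj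
      have h1 : (LinearMap.toMatrix' T) i j = (s j : ℂ)⁻¹ * X i j := by
        have := congrFun ((hcol j).trans (hTs j (by simp [hj]))) i
        simpa using this
      rw [h1]
      field_simp

theorem InUpq.conj_Dmat_eq {p q : ℕ} {g : Matrix (Fin (p + q)) (Fin (p + q)) ℂ}
    (hg : InUpq p q g) (lam s : Fin (p + q) → ℝ) (c : ℝ)
    (hs : ∀ i, s i * s i = etaSign p q i * (lam i - c)) :
    g * Dmat lam * g⁻¹ = (g * Matrix.diagonal fun i => (s i : ℂ)) *
      (g * Matrix.diagonal fun i => (s i : ℂ))ᴴ * etaMat p q + (c : ℂ) • 1 := by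
  have hD : Dmat lam = (Matrix.diagonal fun i => (s i : ℂ)) *
      (Matrix.diagonal fun i => (s i : ℂ))ᴴ * etaMat p q + (c : ℂ) • 1 := by
    rw [etaMat_eq, Matrix.diagonal_conjTranspose, Matrix.diagonal_mul_diagonal,
      Matrix.diagonal_mul_diagonal, Matrix.smul_one_eq_diagonal, Matrix.diagonal_add, Dmat]
    congr 1; ext i
    have h := etaSign_mul_self p q i
    have h2 : lam i = s i * s i * etaSign p q i + c := by
      rw [hs]; linear_combination (c - lam i) * h
    have h3 : star (s i : ℂ) = s i := Complex.conj_ofReal _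
    simp only [Pi.star_apply, h3]
    exact_mod_cast h2
  rw [hD, mul_add, add_mul, Matrix.mul_smul, Matrix.smul_mul, mul_one, hg.mul_inv,
    Matrix.conjTranspose_mul, hg.inv_eq]
  congr 1
  simp only [mul_assoc]
  rw [← mul_assoc (etaMat p q) (etaMat p q), etaMat_mul_self, one_mul]

theorem Zmat_eq (p q : ℕ) :
    Zmat p q = (((p + q : ℝ) / 2 : ℝ) : ℂ) • etaMat p q + (((q - p : ℝ) / 2 : ℝ) : ℂ) • 1 := by
  rw [etaMat_eq, Matrix.smul_one_eq_diagonal, ← Matrix.diagonal_smul, Matrix.diagonal_add, Zmat]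
  congr 1; ext i
  simp only [Pi.smul_apply, smul_eq_mul, etaSign]
  split_ifs <;> push_cast <;> ring

theorem trace_mul_Zmat_re {p q : ℕ} (X : Matrix (Fin (p + q)) (Fin (p + q)) ℂ) (c : ℂ) :
    (Matrix.trace ((X * Xᴴ * etaMat p q + c • 1) * Zmat p q)).re =
      (p + q : ℝ) / 2 * (Matrix.trace (X * Xᴴ)).re +
      (q - p : ℝ) / 2 * (Matrix.trace (Xᴴ * etaMat p q * X)).re +
      (Matrix.trace (c • Zmat p q)).re := by
  rw [add_mul, Matrix.smul_mul, one_mul, Matrix.trace_add, Complex.add_re]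
  congr 1
  rw [Zmat_eq, mul_add, Matrix.mul_smul, Matrix.mul_smul, mul_one, mul_assoc (X * Xᴴ),
    etaMat_mul_self, mul_one, Matrix.trace_add, Matrix.trace_smul, Matrix.trace_smul,
    mul_assoc X, Matrix.trace_mul_comm X (Xᴴ * etaMat p q), Complex.add_re, smul_eq_mul,
    smul_eq_mul, Complex.re_ofReal_mul, Complex.re_ofReal_mul]

theorem norm_sq_le_trace_mul_conjTranspose {m n : Type*} [Fintype m] [Fintype n]
    (X : Matrix m n ℂ) (i : m) (j : n) : ‖X i j‖ ^ 2 ≤ (Matrix.trace (X * Xᴴ)).re := by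
  have h : (Matrix.trace (X * Xᴴ)).re = ∑ i, ∑ j, ‖X i j‖ ^ 2 := by
    simp only [Matrix.trace, Matrix.diag_apply, Matrix.mul_apply, Matrix.conjTranspose_apply,
      Complex.re_sum]
    refine Finset.sum_congr rfl fun i _ => Finset.sum_congr rfl fun j _ => ?_
    have : X i j * star (X i j) = ((‖X i j‖ ^ 2 : ℝ) : ℂ) := by
      push_cast; exact Complex.mul_conj' _
    rw [this, Complex.ofReal_re]
  rw [h]
  calc ‖X i j‖ ^ 2 ≤ ∑ j, ‖X i j‖ ^ 2 :=
        Finset.single_le_sum (f := fun j => ‖X i j‖ ^ 2) (fun _ _ => by positivity)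
          (Finset.mem_univ j)
    _ ≤ _ := Finset.single_le_sum (f := fun i => ∑ j, ‖X i j‖ ^ 2) (fun _ _ => by positivity)
          (Finset.mem_univ i)

theorem isCompact_setOf_norm_apply_le {m n : Type*} (R : ℝ) :
    IsCompact {X : Matrix m n ℂ | ∀ i j, ‖X i j‖ ≤ R} := by
  have h : IsCompact (Set.univ.pi fun _ : m => Set.univ.pi fun _ : n =>
      Metric.closedBall (0 : ℂ) R) :=
    isCompact_univ_pi fun _ => isCompact_univ_pi fun _ => isCompact_closedBall 0 R
  have hset : {X : m → n → ℂ | ∀ i j, ‖X i j‖ ≤ R} = Set.univ.pi fun _ : m =>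
      Set.univ.pi fun _ : n => Metric.closedBall (0 : ℂ) R := by
    ext X
    simp
  exact hset ▸ h

theorem continuous_mul_conjTranspose_mul_add {n : Type*} [Fintype n] (A C : Matrix n n ℂ) :
    Continuous fun X : Matrix n n ℂ => X * Xᴴ * A + C :=
  ((continuous_id.matrix_mul continuous_id.matrix_conjTranspose).matrix_mul
    continuous_const).add continuous_const

/-- The matrices with a prescribed `η`-Gram matrix whose associated orbit point has a prescribed
`z`-component form a compact set. -/
theorem isCompact_gram_level {p : ℕ} (q : ℕ) (hp : 1 ≤ p) (s : Fin (p + q) → ℝ)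
    (G : Matrix (Fin (p + q)) (Fin (p + q)) ℂ) (c : ℂ) (t : ℝ) :
    IsCompact {X : Matrix (Fin (p + q)) (Fin (p + q)) ℂ |
      Xᴴ * etaMat p q * X = G ∧ (∀ i j, s j = 0 → X i j = 0) ∧
        (Matrix.trace ((X * Xᴴ * etaMat p q + c • 1) * Zmat p q)).re = t} := by
  have hGram : Continuous fun X : Matrix (Fin (p + q)) (Fin (p + q)) ℂ =>
      Xᴴ * etaMat p q * X :=
    (continuous_id.matrix_conjTranspose.matrix_mul continuous_const).matrix_mul continuous_id
  have htr : Continuous fun X : Matrix (Fin (p + q)) (Fin (p + q)) ℂ =>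
      (Matrix.trace ((X * Xᴴ * etaMat p q + c • 1) * Zmat p q)).re := by
    have h : Continuous fun X : Matrix (Fin (p + q)) (Fin (p + q)) ℂ =>
        (X * Xᴴ * etaMat p q + c • 1) * Zmat p q :=
      (continuous_mul_conjTranspose_mul_add _ _).matrix_mul continuous_const
    exact Complex.continuous_re.comp h.matrix_trace
  have hzero : IsClosed {X : Matrix (Fin (p + q)) (Fin (p + q)) ℂ |
      ∀ i j, s j = 0 → X i j = 0} := by
    simp only [Set.ofPred_forall]
    exact isClosed_iInter fun i => isClosed_iInter fun j => isClosed_iInter fun _ =>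
      isClosed_eq (continuous_id.matrix_elem i j) continuous_const
  refine (isCompact_setOf_norm_apply_le (√((t - (q - p : ℝ) / 2 * (Matrix.trace G).re -
      (Matrix.trace (c • Zmat p q)).re) / ((p + q : ℝ) / 2)))).of_isClosed_subset
    ((isClosed_eq hGram continuous_const).inter
      (hzero.inter (isClosed_eq htr continuous_const))) ?_
  rintro X ⟨hX, -, hXt⟩ i j
  refine Real.le_sqrt_of_sq_le ((norm_sq_le_trace_mul_conjTranspose X i j).trans_eq ?_)
  have hpos : (0 : ℝ) < (p + q : ℝ) / 2 := by
    have : (1 : ℝ) ≤ p := by exact_mod_cast hp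
    positivity
  rw [trace_mul_Zmat_re, hX] at hXt
  rw [eq_div_iff hpos.ne', ← hXt]
  ring

/-- The subset of the holomorphic orbit `O^{nc}_λ` on which the
`z`-component of the moment map takes a fixed value `t` is compact. -/
theorem orbit_level_set_compact (p q : ℕ) (hp : 1 ≤ p) (hq : 1 ≤ q)
    (lam : Fin (p + q) → ℝ) (hlam : Antitone lam) (t : ℝ) :
    IsCompact {M : Matrix (Fin (p + q)) (Fin (p + q)) ℂ |
      ∃ g : Matrix (Fin (p + q)) (Fin (p + q)) ℂ, InUpq p q g ∧
        M = g * Dmat lam * g⁻¹ ∧ (Matrix.trace (M * Zmat p q)).re = t} := by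
  obtain ⟨c, hc⟩ : ∃ c : ℝ, ∀ i, 0 ≤ etaSign p q i * (lam i - c) := by
    refine ⟨lam ⟨p - 1, by omega⟩, fun i => ?_⟩
    unfold etaSign
    split_ifs with hi
    · have := hlam (show i ≤ ⟨p - 1, by omega⟩ from Fin.mk_le_mk.mpr (by omega))
      linarith
    · have := hlam (show (⟨p - 1, by omega⟩ : Fin (p + q)) ≤ i from Fin.mk_le_mk.mpr (by omega))
      linarith
  obtain ⟨s, hs⟩ : ∃ s : Fin (p + q) → ℝ, ∀ i, s i * s i = etaSign p q i * (lam i - c) :=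
    ⟨fun i => √(etaSign p q i * (lam i - c)), fun i => Real.mul_self_sqrt (hc i)⟩
  let F : Matrix (Fin (p + q)) (Fin (p + q)) ℂ → Matrix (Fin (p + q)) (Fin (p + q)) ℂ :=
    fun X => X * Xᴴ * etaMat p q + (c : ℂ) • 1
  have hF : Continuous F := continuous_mul_conjTranspose_mul_add _ _
  have hK := isCompact_gram_level q hp s
    (Matrix.diagonal fun i => ((etaSign p q i * (s i * s i) : ℝ) : ℂ)) c t
  convert hK.image hF using 1
  ext M
  constructor
  · rintro ⟨g, hg, hM, ht⟩
    have hMF := hM.trans (hg.conj_Dmat_eq lam s c hs)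
    refine ⟨_, ⟨?_, fun i j hj => ?_, ?_⟩, hMF.symm⟩
    · unfold InUpq at hg
      rw [Matrix.conjTranspose_mul, mul_assoc, mul_assoc, ← mul_assoc (etaMat p q),
        ← mul_assoc gᴴ, ← mul_assoc gᴴ, hg, etaMat_eq, Matrix.diagonal_conjTranspose,
        Matrix.diagonal_mul_diagonal, Matrix.diagonal_mul_diagonal]
      refine congrArg Matrix.diagonal (funext fun i => ?_)
      have h3 : star (s i : ℂ) = s i := Complex.conj_ofReal _
      simp only [Pi.star_apply, h3]
      push_cast
      ring
    · rw [Matrix.mul_diagonal, hj, Complex.ofReal_zero, mul_zero]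
    · rw [← ht, hMF]
  · rintro ⟨X, ⟨hX, hX0, hXt⟩, rfl⟩
    obtain ⟨g, hg, rfl⟩ := exists_inUpq_mul_diagonal s X hX hX0
    exact ⟨g, hg, (hg.conj_Dmat_eq lam s c hs).symm, hXt⟩
end

section
/- Consider the quiver Q_{3,3} with E_1 = E_2 = E_3 = ℂ^2 and E_4 = E_5 = E_6 = ℂ, so a representation consists of r_{13}, r_{23} ∈ Hom(ℂ²,ℂ²), r_{43} ∈ Hom(ℂ,ℂ²), r_{45}, r_{46} ∈ ℂ. Let a_1 = (a_1(1) ≥ a_1(2)), a_2 = (a_2(1) ≥ a_2(2)), a_3 = (a_3(1) ≥ a_3(2)) be weakly decreasing real pairs and a_4(1), a_5(1), a_6(1) real numbers. Then there exists a representation r with μ_x(r) = −diag(a_x) for x = 1,…,6 if and only if: a_1(1)+a_1(2)+a_2(1)+a_2(2)+a_3(1)+a_3(2)+a_4(1)+a_5(1)+a_6(1) = 0; a_1(2) ≥ 0; a_2(2) ≥ 0; a_5(1) ≤ 0; a_6(1) ≤ 0; a_1(2)+a_2(2)+a_3(2)+a_4(1)+a_5(1)+a_6(1) ≤ 0; a_1(1)+a_1(2)+a_2(1)+a_2(2)+a_3(1)+a_3(2)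 ≤ 0; a_1(1)+a_2(2)+a_3(2) ≤ 0; a_1(2)+a_2(1)+a_3(2) ≤ 0; a_1(2)+a_2(2)+a_3(1) ≤ 0. -/
open Matrix

/-- A triangle with side lengths `x`, `y`, `d` in the complex plane. -/
theorem exists_complex_triangle {x y d : ℝ} (hx : 0 ≤ x) (hy : 0 ≤ y) (hd : |x - y| ≤ d)
    (hd' : d ≤ x + y) : ∃ z : ℂ, ‖z‖ = y ∧ ‖(x : ℂ) + z‖ = d := by
  have hd0 : 0 ≤ d := (abs_nonneg _).trans hd
  obtain ⟨hl, hu⟩ := abs_le.1 hd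
  obtain ⟨t, ht, htd⟩ : ∃ t : ℝ, |t| ≤ 1 ∧ x ^ 2 + y ^ 2 + 2 * (x * y) * t = d ^ 2 := by
    rcases (mul_nonneg hx hy).eq_or_lt with h | h
    · refine ⟨0, by simp, ?_⟩
      rcases mul_eq_zero.1 h.symm with rfl | rfl
      · have : d = y := by linarith
        subst this; ring
      · have : d = x := by linarith
        subst this; ring
    · refine ⟨(d ^ 2 - x ^ 2 - y ^ 2) / (2 * (x * y)), ?_, by
        rw [mul_div_cancel₀ _ (by positivity)]; ring⟩
      rw [abs_le, le_div_iff₀ (by positivity), div_le_iff₀ (by positivity)]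
      constructor <;> nlinarith
  obtain ⟨h1, h2⟩ := abs_le.1 ht
  have hsq : Real.sqrt (1 - t ^ 2) ^ 2 = 1 - t ^ 2 := Real.sq_sqrt (by nlinarith)
  refine ⟨⟨y * t, y * Real.sqrt (1 - t ^ 2)⟩, ?_, ?_⟩
  · rw [← sq_eq_sq₀ (norm_nonneg _) hy, Complex.sq_norm, Complex.normSq_mk]
    linear_combination y ^ 2 * hsq
  · rw [← sq_eq_sq₀ (norm_nonneg _) hd0, Complex.sq_norm, Complex.normSq_apply]
    simp only [Complex.add_re, Complex.add_im, Complex.ofReal_re, Complex.ofReal_im]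
    linear_combination y ^ 2 * hsq + htd

/-- Two complex numbers of the same norm differ by a rotation. -/
theorem exists_norm_one_mul_eq {z w : ℂ} (h : ‖z‖ = ‖w‖) : ∃ ρ : ℂ, ‖ρ‖ = 1 ∧ ρ * z = w := by
  by_cases hz : z = 0
  · subst hz
    exact ⟨1, by simp, by simpa [eq_comm] using h⟩
  · refine ⟨w / z, ?_, div_mul_cancel₀ _ hz⟩
    rw [norm_div, ← h, div_self (norm_ne_zero_iff.2 hz)]

/-- A closed quadrilateral with prescribed side lengths in the complex plane. -/
theorem exists_complex_quadrilateral {x y z w : ℝ} (hx : 0 ≤ x) (hy : 0 ≤ y) (hz : 0 ≤ z)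
    (hw : 0 ≤ w) (hx' : x ≤ y + z + w) (hy' : y ≤ x + z + w) (hz' : z ≤ x + y + w)
    (hw' : w ≤ x + y + z) :
    ∃ u v t : ℂ, ‖u‖ = x ∧ ‖v‖ = y ∧ ‖t‖ = z ∧ u + v + t = -(w : ℂ) := by
  have hxy : |x - y| ≤ x + y := abs_le.2 ⟨by linarith, by linarith⟩
  have hwz : |w - z| ≤ w + z := abs_le.2 ⟨by linarith, by linarith⟩
  have hxy' : |x - y| ≤ w + z := abs_le.2 ⟨by linarith, by linarith⟩
  have hwz' : |w - z| ≤ x + y := abs_le.2 ⟨by linarith, by linarith⟩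
  obtain ⟨p, hp, hp'⟩ := exists_complex_triangle hx hy (le_max_left _ |w - z|)
    (max_le hxy hwz')
  obtain ⟨q, hq, hq'⟩ := exists_complex_triangle hw hz (le_max_right |x - y| _)
    (max_le hxy' hwz)
  obtain ⟨ρ, hρ, h⟩ := exists_norm_one_mul_eq (z := x + p) (w := -(w + q))
    (by rw [norm_neg, hp', hq'])
  refine ⟨ρ * x, ρ * p, q, ?_, ?_, hq, by linear_combination h⟩
  · rw [norm_mul, hρ, one_mul, Complex.norm_real, Real.norm_of_nonneg hx]
  · rw [norm_mul, hρ, one_mul, hp]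

/-- Half-angle parametrisation of a complex number by a point of the unit circle. -/
theorem exists_half_angle (u : ℂ) : ∃ c s : ℝ, c ^ 2 + s ^ 2 = 1 ∧
    u.re = ‖u‖ * (c ^ 2 - s ^ 2) ∧ u.im = ‖u‖ * (2 * s * c) := by
  refine ⟨Real.cos (u.arg / 2), Real.sin (u.arg / 2), Real.cos_sq_add_sin_sq _, ?_, ?_⟩
  · rw [← Real.cos_two_mul', mul_div_cancel₀ _ two_ne_zero, Complex.norm_mul_cos_arg]
  · rw [← Real.sin_two_mul, mul_div_cancel₀ _ two_ne_zero, Complex.norm_mul_sin_arg]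

/-- A square matrix with prescribed `rᴴ * r` and prescribed real `r * rᴴ`. -/
theorem exists_matrix_of_norm_eq {a : Fin 2 → ℝ} (h0 : 0 ≤ a 1) (h : a 1 ≤ a 0) {u : ℂ}
    (hu : ‖u‖ = (a 0 - a 1) / 2) :
    ∃ r : Matrix (Fin 2) (Fin 2) ℂ, rᴴ * r = diagonal (fun j => ((a j : ℝ) : ℂ)) ∧
      r * rᴴ = !![(((a 0 + a 1) / 2 + u.re : ℝ) : ℂ), ((u.im : ℝ) : ℂ);
        ((u.im : ℝ) : ℂ), (((a 0 + a 1) / 2 - u.re : ℝ) : ℂ)] := by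
  obtain ⟨c, s, hcs, hre, him⟩ := exists_half_angle u
  rw [hu] at hre him
  have e0 : Real.sqrt (a 0) ^ 2 = a 0 := Real.sq_sqrt (h0.trans h)
  have e1 : Real.sqrt (a 1) ^ 2 = a 1 := Real.sq_sqrt h0
  set x := Real.sqrt (a 0)
  set y := Real.sqrt (a 1)
  refine ⟨!![((c * x : ℝ) : ℂ), ((-s * y : ℝ) : ℂ); ((s * x : ℝ) : ℂ), ((c * y : ℝ) : ℂ)], ?_, ?_⟩
  · ext i j
    fin_cases i <;> fin_cases j <;>
      simp only [Matrix.mul_apply, Fin.sum_univ_two, conjTranspose_apply, of_apply, cons_val',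
        cons_val_zero, cons_val_one, cons_val_fin_one, diagonal_apply, Complex.star_def,
        Complex.conj_ofReal, Fin.zero_eta, Fin.mk_one, Fin.isValue, zero_ne_one, one_ne_zero,
        if_true, if_false] <;> norm_cast
    · linear_combination x ^ 2 * hcs + e0
    · ring
    · ring
    · linear_combination y ^ 2 * hcs + e1
  · ext i j
    fin_cases i <;> fin_cases j <;>
      simp only [Matrix.mul_apply, Fin.sum_univ_two, conjTranspose_apply, of_apply, cons_val',
        cons_val_zero, cons_val_one, cons_val_fin_one, Complex.star_def,
        Complex.conj_ofReal, Fin.zero_eta, Fin.mk_one, Fin.isValue] <;> norm_cast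
    · linear_combination c ^ 2 * e0 + s ^ 2 * e1 - hre + (a 0 + a 1) / 2 * hcs
    · linear_combination c * s * e0 - c * s * e1 - him
    · linear_combination c * s * e0 - c * s * e1 - him
    · linear_combination s ^ 2 * e0 + c ^ 2 * e1 + hre + (a 0 + a 1) / 2 * hcs

/-- A column with prescribed norm and prescribed real `r * rᴴ`. -/
theorem exists_column_of_norm_eq {t : ℝ} (ht : 0 ≤ t) {u : ℂ} (hu : ‖u‖ = t / 2) :
    ∃ r : Matrix (Fin 2) (Fin 1) ℂ, rᴴ * r = diagonal (fun _ => (t : ℂ)) ∧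
      r * rᴴ = !![((t / 2 + u.re : ℝ) : ℂ), ((u.im : ℝ) : ℂ);
        ((u.im : ℝ) : ℂ), ((t / 2 - u.re : ℝ) : ℂ)] := by
  obtain ⟨c, s, hcs, hre, him⟩ := exists_half_angle u
  rw [hu] at hre him
  have e : Real.sqrt t ^ 2 = t := Real.sq_sqrt ht
  set x := Real.sqrt t
  refine ⟨!![((c * x : ℝ) : ℂ); ((s * x : ℝ) : ℂ)], ?_, ?_⟩
  · ext i j
    fin_cases i; fin_cases j
    simp only [Matrix.mul_apply, Fin.sum_univ_two, conjTranspose_apply, of_apply, cons_val',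
      cons_val_zero, cons_val_one, cons_val_fin_one, diagonal_apply, Complex.star_def,
      Complex.conj_ofReal, Fin.zero_eta, Fin.isValue, if_true]
    norm_cast
    linear_combination x ^ 2 * hcs + e
  · ext i j
    fin_cases i <;> fin_cases j <;>
      simp only [Matrix.mul_apply, Fin.sum_univ_one, conjTranspose_apply, of_apply, cons_val',
        cons_val_zero, cons_val_one, cons_val_fin_one, Complex.star_def,
        Complex.conj_ofReal, Fin.zero_eta, Fin.mk_one, Fin.isValue] <;> norm_cast
    · linear_combination c ^ 2 * e - hre + t / 2 * hcs
    · linear_combination c * s * e - him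
    · linear_combination c * s * e - him
    · linear_combination s ^ 2 * e + hre + t / 2 * hcs

/-- A `1 × 1` matrix with prescribed squared modulus. -/
theorem exists_scalar_matrix {t : ℝ} (ht : 0 ≤ t) :
    ∃ r : Matrix (Fin 1) (Fin 1) ℂ, rᴴ * r = diagonal (fun _ => (t : ℂ)) ∧
      r * rᴴ = diagonal (fun _ => (t : ℂ)) := by
  refine ⟨diagonal fun _ => ((Real.sqrt t : ℝ) : ℂ), ?_, ?_⟩ <;>
  · rw [diagonal_conjTranspose, diagonal_mul_diagonal]
    congr 1
    funext
    simp only [Pi.star_apply, Complex.star_def, Complex.conj_ofReal]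
    norm_cast
    exact Real.mul_self_sqrt ht

theorem neg_diagonal_const_ofReal {n : Type*} [DecidableEq n] (t : ℝ) :
    -(diagonal fun _ : n => (t : ℂ)) = diagonal fun _ => ((-t : ℝ) : ℂ) := by
  rw [diagonal_neg]
  congr 1
  funext
  simp

theorem conjTranspose_mul_self_fin_one (x : Matrix (Fin 1) (Fin 1) ℂ) : xᴴ * x = x * xᴴ := by
  ext i j
  fin_cases i
  fin_cases j
  simp [Matrix.mul_apply, mul_comm]

/-- The coordinates of the traceless part of a Hermitian `2 × 2` matrix. -/
noncomputable def tracelessVec (H : Matrix (Fin 2) (Fin 2) ℂ) : EuclideanSpace ℝ (Fin 3) :=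
  !₂[((H 0 0).re - (H 1 1).re) / 2, (H 0 1).re, (H 0 1).im]

theorem tracelessVec_add (H K : Matrix (Fin 2) (Fin 2) ℂ) :
    tracelessVec (H + K) = tracelessVec H + tracelessVec K := by
  ext i
  fin_cases i <;> simp [tracelessVec]
  ring

theorem norm_tracelessVec {H : Matrix (Fin 2) (Fin 2) ℂ} {d : ℝ} (hd : 0 ≤ d)
    (h : (((H 0 0).re - (H 1 1).re) / 2) ^ 2 + ((H 0 1).re ^ 2 + (H 0 1).im ^ 2) = d ^ 2) :
    ‖tracelessVec H‖ = d := by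
  rw [← sq_eq_sq₀ (norm_nonneg _) hd, EuclideanSpace.real_norm_sq_eq, Fin.sum_univ_three, ← h]
  simp [tracelessVec, add_assoc]

open scoped ComplexOrder in
theorem conjTranspose_mul_self_diag_nonneg {m n : Type*} [Fintype m] [Finite n] [DecidableEq n]
    {r : Matrix m n ℂ} {a : n → ℝ} (h : rᴴ * r = diagonal fun j => (a j : ℂ)) (j : n) :
    0 ≤ a j := by
  have h1 := (posSemidef_conjTranspose_mul_self r).diag_nonneg (i := j)
  rw [h, diagonal_apply_eq] at h1
  exact_mod_cast h1

/-- If `rᴴ * r` is diagonal with real entries `a`, the trace of `r * rᴴ` is `a 0 + a 1` and its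
traceless part has norm `(a 0 - a 1) / 2`. -/
theorem mul_conjTranspose_invariants {r : Matrix (Fin 2) (Fin 2) ℂ} {a : Fin 2 → ℝ}
    (ha : a 1 ≤ a 0) (h : rᴴ * r = diagonal fun j => (a j : ℂ)) :
    ((r * rᴴ) 0 0).re + ((r * rᴴ) 1 1).re = a 0 + a 1 ∧
      ‖tracelessVec (r * rᴴ)‖ = (a 0 - a 1) / 2 := by
  have htr : (r * rᴴ).trace = (rᴴ * r).trace := trace_mul_comm _ _
  have hdet : (r * rᴴ).det = (rᴴ * r).det := det_mul_comm _ _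
  have hH : (r * rᴴ).IsHermitian := isHermitian_mul_conjTranspose_self r
  rw [h] at htr hdet
  generalize r * rᴴ = H at *
  have h00 : (H 0 0).im = 0 := Complex.conj_eq_iff_im.1 (hH.apply 0 0)
  have h11 : (H 1 1).im = 0 := Complex.conj_eq_iff_im.1 (hH.apply 1 1)
  have h10 : H 1 0 = star (H 0 1) := (hH.apply 1 0).symm
  have htr' := congrArg Complex.re htr
  have hdet' := congrArg Complex.re hdet
  simp [trace_fin_two] at htr'
  simp [det_fin_two, h10, h00, h11] at hdet'
  refine ⟨htr', norm_tracelessVec (by linarith) ?_⟩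
  linear_combination ((H 0 0).re + (H 1 1).re + a 0 + a 1) / 4 * htr' - hdet'

/-- The analogue of `mul_conjTranspose_invariants` for a column. -/
theorem column_mul_conjTranspose_invariants (r : Matrix (Fin 2) (Fin 1) ℂ) :
    ((r * rᴴ) 0 0).re + ((r * rᴴ) 1 1).re = ((rᴴ * r) 0 0).re ∧
      ‖tracelessVec (r * rᴴ)‖ = ((rᴴ * r) 0 0).re / 2 := by
  constructor
  · simp [Matrix.mul_apply]
  · apply norm_tracelessVec
    · simp only [Matrix.mul_apply, Fin.sum_univ_two, conjTranspose_apply, Complex.star_def,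
        Complex.add_re, Complex.mul_re, Complex.conj_re, Complex.conj_im]
      nlinarith [sq_nonneg (r 0 0).re, sq_nonneg (r 0 0).im, sq_nonneg (r 1 0).re,
        sq_nonneg (r 1 0).im]
    · simp [Matrix.mul_apply]
      ring

/-- the cone `Cone_{Q_{3,3}}(2,1)`, Example 1 of the paper. -/
theorem coneQ33_two_one
    (a₁ a₂ a₃ : Fin 2 → ℝ) (a₄ a₅ a₆ : ℝ)
    (h₁ : a₁ 1 ≤ a₁ 0) (h₂ : a₂ 1 ≤ a₂ 0) (h₃ : a₃ 1 ≤ a₃ 0) :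
    (∃ (r13 r23 : Matrix (Fin 2) (Fin 2) ℂ) (r43 : Matrix (Fin 2) (Fin 1) ℂ)
        (r45 r46 : Matrix (Fin 1) (Fin 1) ℂ),
        -(r13ᴴ * r13) = -(Matrix.diagonal fun j : Fin 2 => ((a₁ j : ℝ) : ℂ)) ∧
        -(r23ᴴ * r23) = -(Matrix.diagonal fun j : Fin 2 => ((a₂ j : ℝ) : ℂ)) ∧
        r13 * r13ᴴ + r23 * r23ᴴ + r43 * r43ᴴ =
          -(Matrix.diagonal fun j : Fin 2 => ((a₃ j : ℝ) : ℂ)) ∧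
        -(r43ᴴ * r43 + r45ᴴ * r45 + r46ᴴ * r46) =
          -(Matrix.diagonal fun _ : Fin 1 => ((a₄ : ℝ) : ℂ)) ∧
        r45 * r45ᴴ = -(Matrix.diagonal fun _ : Fin 1 => ((a₅ : ℝ) : ℂ)) ∧
        r46 * r46ᴴ = -(Matrix.diagonal fun _ : Fin 1 => ((a₆ : ℝ) : ℂ))) ↔
      (a₁ 0 + a₁ 1 + a₂ 0 + a₂ 1 + a₃ 0 + a₃ 1 + a₄ + a₅ + a₆ = 0 ∧
       0 ≤ a₁ 1 ∧ 0 ≤ a₂ 1 ∧ a₅ ≤ 0 ∧ a₆ ≤ 0 ∧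
       a₁ 1 + a₂ 1 + a₃ 1 + a₄ + a₅ + a₆ ≤ 0 ∧
       a₁ 0 + a₁ 1 + a₂ 0 + a₂ 1 + a₃ 0 + a₃ 1 ≤ 0 ∧
       a₁ 0 + a₂ 1 + a₃ 1 ≤ 0 ∧
       a₁ 1 + a₂ 0 + a₃ 1 ≤ 0 ∧
       a₁ 1 + a₂ 1 + a₃ 0 ≤ 0) := by
  constructor
  · rintro ⟨r, s, v, x, y, hr, hs, hv, h4, h5, h6⟩
    rw [neg_inj] at hr hs h4
    obtain ⟨tr, nr⟩ := mul_conjTranspose_invariants h₁ hr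
    obtain ⟨ts, ns⟩ := mul_conjTranspose_invariants h₂ hs
    obtain ⟨tv, nv⟩ := column_mul_conjTranspose_invariants v
    have hx : xᴴ * x = diagonal fun _ => ((-a₅ : ℝ) : ℂ) := by
      rw [conjTranspose_mul_self_fin_one, h5, neg_diagonal_const_ofReal]
    have hy : yᴴ * y = diagonal fun _ => ((-a₆ : ℝ) : ℂ) := by
      rw [conjTranspose_mul_self_fin_one, h6, neg_diagonal_const_ofReal]
    have p5 := conjTranspose_mul_self_diag_nonneg hx 0
    have p6 := conjTranspose_mul_self_diag_nonneg hy 0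
    have p1 := conjTranspose_mul_self_diag_nonneg hr 1
    have p2 := conjTranspose_mul_self_diag_nonneg hs 1
    have ht : ((vᴴ * v) 0 0).re = a₄ + a₅ + a₆ := by
      rw [hx, hy] at h4
      have := congrArg Complex.re (congrFun (congrFun h4 0) 0)
      simp only [Matrix.add_apply, diagonal_apply_eq, Complex.add_re, Complex.ofReal_re] at this
      linarith
    rw [ht] at tv nv
    have n3 : ‖tracelessVec (r * rᴴ + s * sᴴ + v * vᴴ)‖ = (a₃ 0 - a₃ 1) / 2 := by
      rw [hv]
      apply norm_tracelessVec (by linarith)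
      simp
      ring
    have t3 : a₁ 0 + a₁ 1 + (a₂ 0 + a₂ 1) + (a₄ + a₅ + a₆) = -a₃ 0 + -a₃ 1 := by
      have e0 := congrArg Complex.re (congrFun (congrFun hv 0) 0)
      have e1 := congrArg Complex.re (congrFun (congrFun hv 1) 1)
      simp only [Matrix.add_apply, Matrix.neg_apply, diagonal_apply_eq, Complex.add_re,
        Complex.neg_re, Complex.ofReal_re] at e0 e1
      linarith
    rw [tracelessVec_add, tracelessVec_add] at n3
    generalize tracelessVec (r * rᴴ) = R at *
    generalize tracelessVec (s * sᴴ) = S at *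
    generalize tracelessVec (v * vᴴ) = T at *
    have i0 := norm_add₃_le (a := R) (b := S) (c := T)
    have i1 := norm_add₃_le (a := R + S + T) (b := -S) (c := -T)
    have i2 := norm_add₃_le (a := R + S + T) (b := -R) (c := -T)
    have i3 := norm_add₃_le (a := R + S + T) (b := -R) (c := -S)
    rw [show R + S + T + -S + -T = R by abel, norm_neg, norm_neg] at i1
    rw [show R + S + T + -R + -T = S by abel, norm_neg, norm_neg] at i2
    rw [show R + S + T + -R + -S = T by abel, norm_neg, norm_neg] at i3
    have := norm_nonneg T
    refine ⟨?_, ?_, ?_, ?_, ?_, ?_, ?_, ?_, ?_, ?_⟩ <;> linarith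
  · rintro ⟨hsum, p1, p2, p5, p6, q1, q2, q3, q4, q5⟩
    obtain ⟨u, v, w, hu, hv, hw, huvw⟩ := exists_complex_quadrilateral
      (x := (a₁ 0 - a₁ 1) / 2) (y := (a₂ 0 - a₂ 1) / 2) (z := (a₄ + a₅ + a₆) / 2)
      (w := (a₃ 0 - a₃ 1) / 2) (by linarith) (by linarith) (by linarith) (by linarith)
      (by linarith) (by linarith) (by linarith) (by linarith)
    obtain ⟨r, hr, hr'⟩ := exists_matrix_of_norm_eq p1 h₁ hu
    obtain ⟨s, hs, hs'⟩ := exists_matrix_of_norm_eq p2 h₂ hv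
    obtain ⟨t, ht, ht'⟩ := exists_column_of_norm_eq (by linarith) hw
    obtain ⟨x, hx, hx'⟩ := exists_scalar_matrix (neg_nonneg.2 p5)
    obtain ⟨y, hy, hy'⟩ := exists_scalar_matrix (neg_nonneg.2 p6)
    refine ⟨r, s, t, x, y, by rw [hr], by rw [hs], ?_, ?_, ?_, ?_⟩
    · have hre := congrArg Complex.re huvw
      have him := congrArg Complex.im huvw
      simp only [Complex.add_re, Complex.add_im, Complex.neg_re, Complex.neg_im,
        Complex.ofReal_re, Complex.ofReal_im, neg_zero] at hre him
      rw [hr', hs', ht']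
      ext i j
      fin_cases i <;> fin_cases j <;>
        simp only [Matrix.add_apply, Matrix.neg_apply, of_apply, cons_val', cons_val_zero,
          cons_val_one, cons_val_fin_one, diagonal_apply, Fin.zero_eta, Fin.mk_one, Fin.isValue,
          zero_ne_one, one_ne_zero, if_true, if_false, neg_zero] <;> norm_cast <;> linarith
    · rw [ht, hx, hy, diagonal_add, diagonal_add]
      congr 2
      funext
      push_cast
      ring
    · rw [hx', neg_diagonal_const_ofReal]
    · rw [hy', neg_diagonal_const_ofReal]
end

section
/- Consider the quiver Q_{3,3} with E_x = ℂ² for all six vertices, so a representation consists of r_{13}, r_{23}, r_{43}, r_{45}, r_{46} ∈ Hom(ℂ²,ℂ²). Let a_1,…,a_6 be weakly decreasing real pairs a_x = (a_x(1) ≥ a_x(2)). Then there exists a representation r with μ_x(r) = −diag(a_x) for x = 1,…,6 if and only if: Σ_{x=1}^{6}(a_x(1)+a_x(2)) = 0; a_1(2) ≥ 0; a_2(2) ≥ 0; a_5(1) ≤ 0; a_6(1) ≤ 0; and the thirteen inequalities: a_1(1)+a_2(2)+a_3(2) ≤ 0; a_1(2)+a_2(1)+a_3(2) ≤ 0; a_1(2)+a_2(2)+a_3(1)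 ≤ 0; a_1(1)+a_1(2)+a_2(1)+a_2(2)+a_3(1)+a_3(2) ≤ 0; a_1(2)+a_2(2)+a_3(2)+a_4(1)+a_5(2)+a_6(2) ≤ 0; a_1(2)+a_2(2)+a_3(2)+a_4(2)+a_5(1)+a_6(2) ≤ 0; a_1(2)+a_2(2)+a_3(2)+a_4(2)+a_5(2)+a_6(1) ≤ 0; a_1(1)+a_2(2)+a_3(2)+a_4(2)+a_5(2)+a_6(2) ≤ 0; a_1(2)+a_2(1)+a_3(2)+a_4(2)+a_5(2)+a_6(2) ≤ 0; a_1(2)+a_2(2)+a_3(1)+a_4(2)+a_5(2)+a_6(2) ≤ 0; a_1(1)+a_1(2)+a_2(1)+a_2(2)+a_3(1)+a_3(2)+a_4(1)+a_5(2)+a_6(2) ≤ 0; a_1(1)+a_1(2)+a_2(1)+a_2(2)+a_3(1)+a_3(2)+a_4(2)+a_5(1)+a_6(2) ≤ 0; a_1(1)+a_1(2)+a_2(1)+a_2(2)+a_3(1)+a_3(2)+a_4(2)+a_5(2)+a_6(1) ≤ 0. -/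
open Matrix

/-- The traceless part of a Hermitian `2 × 2` matrix, as a vector in Euclidean space. -/
noncomputable def blochVector (M : Matrix (Fin 2) (Fin 2) ℂ) : EuclideanSpace ℝ (Fin 3) :=
  !₂[(M 0 0 - M 1 1).re, 2 * (M 0 1).re, 2 * (M 0 1).im]

theorem blochVector_add (M N : Matrix (Fin 2) (Fin 2) ℂ) :
    blochVector (M + N) = blochVector M + blochVector N := by
  ext i
  fin_cases i <;> simp [blochVector] <;> ring

theorem blochVector_neg (M : Matrix (Fin 2) (Fin 2) ℂ) :
    blochVector (-M) = -blochVector M := by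
  ext i
  fin_cases i <;> simp [blochVector, neg_add_eq_sub]

theorem norm_blochVector_diagonal (a : Fin 2 → ℝ) (h : a 1 ≤ a 0) :
    ‖blochVector (Matrix.diagonal fun j => ((a j : ℝ) : ℂ))‖ = a 0 - a 1 := by
  rw [EuclideanSpace.norm_eq]
  simp [blochVector, Fin.sum_univ_three, Real.sqrt_sq_eq_abs, abs_of_nonneg (sub_nonneg.2 h)]

theorem norm_sq_blochVector {M : Matrix (Fin 2) (Fin 2) ℂ} (hM : M.IsHermitian) :
    ‖blochVector M‖ ^ 2 = M.trace.re ^ 2 - 4 * M.det.re := by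
  have h00 : (M 0 0).im = 0 := by
    have := congrArg Complex.im (hM.apply 0 0)
    simp at this
    linarith
  have h11 : (M 1 1).im = 0 := by
    have := congrArg Complex.im (hM.apply 1 1)
    simp at this
    linarith
  have h10 : M 1 0 = star (M 0 1) := (hM.apply 1 0).symm
  rw [EuclideanSpace.norm_sq_eq]
  simp [blochVector, Fin.sum_univ_three, Matrix.trace_fin_two, Matrix.det_fin_two, h00, h10]
  ring

theorem norm_blochVector_mul_conjTranspose (r : Matrix (Fin 2) (Fin 2) ℂ) :
    ‖blochVector (r * rᴴ)‖ = ‖blochVector (rᴴ * r)‖ := by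
  rw [← sq_eq_sq₀ (norm_nonneg _) (norm_nonneg _),
    norm_sq_blochVector (Matrix.isHermitian_mul_conjTranspose_self r),
    norm_sq_blochVector (Matrix.isHermitian_conjTranspose_mul_self r),
    Matrix.trace_mul_comm, Matrix.det_mul_comm]

open scoped ComplexOrder in
theorem trace_mul_conjTranspose_re_nonneg (r : Matrix (Fin 2) (Fin 2) ℂ) :
    0 ≤ (r * rᴴ).trace.re :=
  (Complex.nonneg_iff.1 (Matrix.posSemidef_self_mul_conjTranspose r).trace_nonneg).1

open scoped ComplexOrder in
theorem norm_blochVector_le_trace (r : Matrix (Fin 2) (Fin 2) ℂ) :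
    ‖blochVector (r * rᴴ)‖ ≤ (r * rᴴ).trace.re := by
  rw [← sq_le_sq₀ (norm_nonneg _) (trace_mul_conjTranspose_re_nonneg r),
    norm_sq_blochVector (Matrix.isHermitian_mul_conjTranspose_self r)]
  have := (Complex.nonneg_iff.1 (Matrix.posSemidef_self_mul_conjTranspose r).det_nonneg).1
  linarith

theorem norm_le_of_add_eq_zero {E : Type*} [NormedAddCommGroup E] {u v w z : E}
    (h : u + v + w + z = 0) : ‖u‖ ≤ ‖v‖ + ‖w‖ + ‖z‖ := by
  have hu : u = -(v + w + z) := by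
    rw [eq_neg_iff_add_eq_zero, ← h]
    abel
  rw [hu, norm_neg]
  exact norm_add₃_le

/-- The four-sided polygon inequalities satisfied by Hermitian matrices with zero sum. -/
theorem blochVector_polygon {A B C D : Matrix (Fin 2) (Fin 2) ℂ} (h : A + B + C = -D) :
    ‖blochVector A‖ ≤ ‖blochVector B‖ + ‖blochVector C‖ + ‖blochVector D‖ ∧
    ‖blochVector B‖ ≤ ‖blochVector A‖ + ‖blochVector C‖ + ‖blochVector D‖ ∧
    ‖blochVector C‖ ≤ ‖blochVector A‖ + ‖blochVector B‖ + ‖blochVector D‖ ∧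
    ‖blochVector D‖ ≤ ‖blochVector A‖ + ‖blochVector B‖ + ‖blochVector C‖ := by
  have h0 : blochVector A + blochVector B + blochVector C + blochVector D = 0 := by
    rw [← blochVector_add, ← blochVector_add, h, blochVector_neg, neg_add_cancel]
  refine ⟨norm_le_of_add_eq_zero h0, norm_le_of_add_eq_zero ?_, norm_le_of_add_eq_zero ?_,
    norm_le_of_add_eq_zero ?_⟩
  all_goals
    rw [← h0]
    abel

/-- The symmetric real matrix with half-trace `t` and traceless part encoded by `w`. -/
noncomputable def symMatrix (t : ℝ) (w : ℂ) : Matrix (Fin 2) (Fin 2) ℂ :=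
  !![((t + w.re : ℝ) : ℂ), ((w.im : ℝ) : ℂ); ((w.im : ℝ) : ℂ), ((t - w.re : ℝ) : ℂ)]

theorem symMatrix_add (s t : ℝ) (v w : ℂ) :
    symMatrix s v + symMatrix t w = symMatrix (s + t) (v + w) := by
  ext i j
  fin_cases i <;> fin_cases j <;> simp [symMatrix] <;> ring

theorem diagonal_eq_symMatrix (a : Fin 2 → ℝ) :
    (Matrix.diagonal fun j => ((a j : ℝ) : ℂ)) =
      symMatrix ((a 0 + a 1) / 2) (((a 0 - a 1) / 2 : ℝ) : ℂ) := by
  ext i j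
  fin_cases i <;> fin_cases j <;> simp [symMatrix] <;> ring

theorem neg_diagonal_eq_symMatrix (a : Fin 2 → ℝ) :
    -(Matrix.diagonal fun j => ((a j : ℝ) : ℂ)) =
      symMatrix ((-a 0 + -a 1) / 2) (((-a 0 - -a 1) / 2 : ℝ) : ℂ) := by
  rw [← diagonal_eq_symMatrix fun j => -a j, Matrix.diagonal_neg]
  congr 1
  ext j
  simp

/-- The rotation matrix attached to a complex number. -/
noncomputable def rotMatrix (u : ℂ) : Matrix (Fin 2) (Fin 2) ℂ :=
  !![(u.re : ℂ), -(u.im : ℂ); (u.im : ℂ), (u.re : ℂ)]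

theorem re_sq_add_im_sq {u : ℂ} (hu : ‖u‖ = 1) : u.re * u.re + u.im * u.im = 1 := by
  rw [← Complex.normSq_apply, Complex.normSq_eq_norm_sq, hu, one_pow]

theorem rotMatrix_conjTranspose_mul {u : ℂ} (hu : ‖u‖ = 1) :
    (rotMatrix u)ᴴ * rotMatrix u = 1 := by
  have h : (u.re : ℂ) * u.re + u.im * u.im = 1 := by exact_mod_cast re_sq_add_im_sq hu
  ext i j
  fin_cases i <;> fin_cases j <;> simp [rotMatrix, Matrix.mul_apply]
  · exact h
  · ring
  · ring
  · linear_combination h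

theorem rotMatrix_mul_diagonal_mul {u : ℂ} (hu : ‖u‖ = 1) (p q : ℝ) :
    rotMatrix u * Matrix.diagonal ![(p : ℂ), (q : ℂ)] * (rotMatrix u)ᴴ =
      symMatrix ((p + q) / 2) (((p - q) / 2 : ℝ) * u ^ 2) := by
  have h : (u.re : ℂ) * u.re + u.im * u.im = 1 := by exact_mod_cast re_sq_add_im_sq hu
  ext i j
  fin_cases i <;> fin_cases j <;>
    simp [rotMatrix, symMatrix, Matrix.mul_apply, Matrix.vecMul_diagonal, sq]
  · linear_combination ((p + q) / 2 : ℂ) * h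
  · ring
  · ring
  · linear_combination ((p + q) / 2 : ℂ) * h

theorem exists_norm_eq_one_sq_eq {z : ℂ} (hz : ‖z‖ = 1) : ∃ u : ℂ, ‖u‖ = 1 ∧ u ^ 2 = z := by
  obtain ⟨u, hu⟩ := IsAlgClosed.exists_pow_nat_eq z (n := 2) (by norm_num)
  refine ⟨u, ?_, hu⟩
  rw [← pow_eq_one_iff_of_nonneg (norm_nonneg u) two_ne_zero, ← norm_pow, hu, hz]

/-- A matrix with squared singular values `p, q` and prescribed singular directions. -/
theorem exists_singular_decomposition {p q : ℝ} (hp : 0 ≤ p) (hq : 0 ≤ q) {z w : ℂ}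
    (hz : ‖z‖ = 1) (hw : ‖w‖ = 1) :
    ∃ r : Matrix (Fin 2) (Fin 2) ℂ,
      r * rᴴ = symMatrix ((p + q) / 2) (((p - q) / 2 : ℝ) * z) ∧
      rᴴ * r = symMatrix ((p + q) / 2) (((p - q) / 2 : ℝ) * w) := by
  obtain ⟨u, hu, rfl⟩ := exists_norm_eq_one_sq_eq hz
  obtain ⟨v, hv, rfl⟩ := exists_norm_eq_one_sq_eq hw
  set D : Matrix (Fin 2) (Fin 2) ℂ := Matrix.diagonal ![(√p : ℂ), (√q : ℂ)] with hD
  have hDs : Dᴴ = D := by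
    ext i j
    fin_cases i <;> fin_cases j <;> simp [hD]
  have hDD : D * D = Matrix.diagonal ![(p : ℂ), (q : ℂ)] := by
    have h1 : (√p : ℂ) * √p = p := by exact_mod_cast Real.mul_self_sqrt hp
    have h2 : (√q : ℂ) * √q = q := by exact_mod_cast Real.mul_self_sqrt hq
    rw [hD, Matrix.diagonal_mul_diagonal]
    congr 1
    ext i
    fin_cases i <;> simp [h1, h2]
  refine ⟨rotMatrix u * D * (rotMatrix v)ᴴ, ?_, ?_⟩
  · rw [← rotMatrix_mul_diagonal_mul hu, ← hDD]
    simp only [Matrix.conjTranspose_mul, Matrix.conjTranspose_conjTranspose, hDs]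
    calc _ = rotMatrix u * D * ((rotMatrix v)ᴴ * rotMatrix v) * (D * (rotMatrix u)ᴴ) := by
            simp only [Matrix.mul_assoc]
      _ = _ := by
            rw [rotMatrix_conjTranspose_mul hv]
            simp only [Matrix.mul_assoc, Matrix.one_mul]
  · rw [← rotMatrix_mul_diagonal_mul hv, ← hDD]
    simp only [Matrix.conjTranspose_mul, Matrix.conjTranspose_conjTranspose, hDs]
    calc _ = rotMatrix v * D * ((rotMatrix u)ᴴ * rotMatrix u) * (D * (rotMatrix v)ᴴ) := by
            simp only [Matrix.mul_assoc]
      _ = _ := by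
            rw [rotMatrix_conjTranspose_mul hu]
            simp only [Matrix.mul_assoc, Matrix.one_mul]

/-- A planar triangle with side lengths `p, q, s`, one side lying on the positive real axis. -/
theorem exists_triangle {p q s : ℝ} (hp : 0 ≤ p) (hq : 0 ≤ q) (hs : 0 ≤ s)
    (h₁ : p ≤ q + s) (h₂ : q ≤ p + s) (h₃ : s ≤ p + q) :
    ∃ z w : ℂ, ‖z‖ = 1 ∧ ‖w‖ = 1 ∧ p * z + q * w = s := by
  have key : ∃ z : ℂ, ‖z‖ = 1 ∧ ‖(s : ℂ) - p * z‖ = q := by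
    have hcont : ContinuousOn (fun t : ℝ => ‖(s : ℂ) - p * Complex.exp (t * Complex.I)‖)
        (Set.Icc 0 Real.pi) := by fun_prop
    have h0 : ‖(s : ℂ) - p * Complex.exp ((0 : ℝ) * Complex.I)‖ = |s - p| := by
      rw [← Real.norm_eq_abs, ← Complex.norm_real]
      simp
    have hpi : ‖(s : ℂ) - p * Complex.exp ((Real.pi : ℝ) * Complex.I)‖ = s + p := by
      rw [Complex.exp_pi_mul_I, ← abs_of_nonneg (add_nonneg hs hp), ← Real.norm_eq_abs,
        ← Complex.norm_real]
      simp
    obtain ⟨t, -, ht⟩ := intermediate_value_Icc Real.pi_nonneg hcont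
      (show q ∈ Set.Icc _ _ by
        constructor
        · rw [h0]
          exact abs_le.2 ⟨by linarith, by linarith⟩
        · rw [hpi]
          linarith)
    exact ⟨_, Complex.norm_exp_ofReal_mul_I t, ht⟩
  obtain ⟨z, hz, hzq⟩ := key
  rcases hq.eq_or_lt with rfl | hq0
  · refine ⟨z, 1, hz, norm_one, ?_⟩
    rw [norm_eq_zero, sub_eq_zero] at hzq
    rw [hzq]
    simp
  · have hqc : (q : ℂ) ≠ 0 := by exact_mod_cast hq0.ne'
    refine ⟨z, ((s : ℂ) - p * z) / q, hz, ?_, ?_⟩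
    · rw [norm_div, hzq, Complex.norm_real, Real.norm_of_nonneg hq, div_self hq0.ne']
    · field_simp
      ring

/-- A planar quadrilateral with side lengths satisfying the polygon inequalities. -/
theorem exists_quadrilateral {p q s t : ℝ} (hp : 0 ≤ p) (hq : 0 ≤ q) (hs : 0 ≤ s) (ht : 0 ≤ t)
    (h₁ : p ≤ q + s + t) (h₂ : q ≤ p + s + t) (h₃ : s ≤ p + q + t) (h₄ : t ≤ p + q + s) :
    ∃ x y z : ℂ, ‖x‖ = 1 ∧ ‖y‖ = 1 ∧ ‖z‖ = 1 ∧ p * x + q * y + s * z = t := by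
  obtain ⟨m, hm0, hm1, hm2, hm3, hm4, hm5, hm6⟩ : ∃ m : ℝ, 0 ≤ m ∧ p ≤ q + m ∧ q ≤ p + m ∧
      m ≤ p + q ∧ s ≤ t + m ∧ t ≤ s + m ∧ m ≤ s + t := by
    refine ⟨max |p - q| |s - t|, le_max_of_le_left (abs_nonneg _), ?_, ?_, ?_, ?_, ?_, ?_⟩
    · linarith [le_max_left |p - q| |s - t|, le_abs_self (p - q)]
    · linarith [le_max_left |p - q| |s - t|, neg_le_abs (p - q)]
    · exact max_le (abs_le.2 ⟨by linarith, by linarith⟩) (abs_le.2 ⟨by linarith, by linarith⟩)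
    · linarith [le_max_right |p - q| |s - t|, le_abs_self (s - t)]
    · linarith [le_max_right |p - q| |s - t|, neg_le_abs (s - t)]
    · exact max_le (abs_le.2 ⟨by linarith, by linarith⟩) (abs_le.2 ⟨by linarith, by linarith⟩)
  obtain ⟨x, y, hx, hy, hxy⟩ := exists_triangle hp hq hm0 hm1 hm2 hm3
  obtain ⟨w, z, hw, hz, hwz⟩ := exists_triangle hm0 hs ht (by linarith) (by linarith) (by linarith)
  refine ⟨x * w, y * w, z, by rw [norm_mul, hx, hw, one_mul], by rw [norm_mul, hy, hw, one_mul],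
    hz, ?_⟩
  linear_combination w * hxy + hwz


/-- the cone `Cone_{Q_{3,3}}(2,2)`. -/
theorem coneQ33_two_two
    (a₁ a₂ a₃ a₄ a₅ a₆ : Fin 2 → ℝ)
    (h₁ : a₁ 1 ≤ a₁ 0) (h₂ : a₂ 1 ≤ a₂ 0) (h₃ : a₃ 1 ≤ a₃ 0)
    (h₄ : a₄ 1 ≤ a₄ 0) (h₅ : a₅ 1 ≤ a₅ 0) (h₆ : a₆ 1 ≤ a₆ 0) :
    (∃ r13 r23 r43 r45 r46 : Matrix (Fin 2) (Fin 2) ℂ,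
        -(r13ᴴ * r13) = -(Matrix.diagonal fun j : Fin 2 => ((a₁ j : ℝ) : ℂ)) ∧
        -(r23ᴴ * r23) = -(Matrix.diagonal fun j : Fin 2 => ((a₂ j : ℝ) : ℂ)) ∧
        r13 * r13ᴴ + r23 * r23ᴴ + r43 * r43ᴴ =
          -(Matrix.diagonal fun j : Fin 2 => ((a₃ j : ℝ) : ℂ)) ∧
        -(r43ᴴ * r43 + r45ᴴ * r45 + r46ᴴ * r46) =
          -(Matrix.diagonal fun j : Fin 2 => ((a₄ j : ℝ) : ℂ)) ∧
        r45 * r45ᴴ = -(Matrix.diagonal fun j : Fin 2 => ((a₅ j : ℝ) : ℂ)) ∧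
        r46 * r46ᴴ = -(Matrix.diagonal fun j : Fin 2 => ((a₆ j : ℝ) : ℂ))) ↔
      ((a₁ 0 + a₁ 1) + (a₂ 0 + a₂ 1) + (a₃ 0 + a₃ 1) + (a₄ 0 + a₄ 1) + (a₅ 0 + a₅ 1) +
          (a₆ 0 + a₆ 1) = 0 ∧
       0 ≤ a₁ 1 ∧ 0 ≤ a₂ 1 ∧ a₅ 0 ≤ 0 ∧ a₆ 0 ≤ 0 ∧
       a₁ 0 + a₂ 1 + a₃ 1 ≤ 0 ∧
       a₁ 1 + a₂ 0 + a₃ 1 ≤ 0 ∧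
       a₁ 1 + a₂ 1 + a₃ 0 ≤ 0 ∧
       a₁ 0 + a₁ 1 + a₂ 0 + a₂ 1 + a₃ 0 + a₃ 1 ≤ 0 ∧
       a₁ 1 + a₂ 1 + a₃ 1 + a₄ 0 + a₅ 1 + a₆ 1 ≤ 0 ∧
       a₁ 1 + a₂ 1 + a₃ 1 + a₄ 1 + a₅ 0 + a₆ 1 ≤ 0 ∧
       a₁ 1 + a₂ 1 + a₃ 1 + a₄ 1 + a₅ 1 + a₆ 0 ≤ 0 ∧
       a₁ 0 + a₂ 1 + a₃ 1 + a₄ 1 + a₅ 1 + a₆ 1 ≤ 0 ∧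
       a₁ 1 + a₂ 0 + a₃ 1 + a₄ 1 + a₅ 1 + a₆ 1 ≤ 0 ∧
       a₁ 1 + a₂ 1 + a₃ 0 + a₄ 1 + a₅ 1 + a₆ 1 ≤ 0 ∧
       a₁ 0 + a₁ 1 + a₂ 0 + a₂ 1 + a₃ 0 + a₃ 1 + a₄ 0 + a₅ 1 + a₆ 1 ≤ 0 ∧
       a₁ 0 + a₁ 1 + a₂ 0 + a₂ 1 + a₃ 0 + a₃ 1 + a₄ 1 + a₅ 0 + a₆ 1 ≤ 0 ∧
       a₁ 0 + a₁ 1 + a₂ 0 + a₂ 1 + a₃ 0 + a₃ 1 + a₄ 1 + a₅ 1 + a₆ 0 ≤ 0) := by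
  constructor
  · rintro ⟨r13, r23, r43, r45, r46, e1, e2, e3, e4, e5, e6⟩
    rw [neg_inj] at e1 e2 e4
    have n1 := norm_blochVector_mul_conjTranspose r13
    have n2 := norm_blochVector_mul_conjTranspose r23
    have n3 := norm_blochVector_mul_conjTranspose r43
    have n5 := norm_blochVector_mul_conjTranspose r45
    have n6 := norm_blochVector_mul_conjTranspose r46
    rw [e1, norm_blochVector_diagonal _ h₁] at n1
    rw [e2, norm_blochVector_diagonal _ h₂] at n2
    rw [e5, blochVector_neg, norm_neg, norm_blochVector_diagonal _ h₅] at n5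
    rw [e6, blochVector_neg, norm_neg, norm_blochVector_diagonal _ h₆] at n6
    have hle := norm_blochVector_le_trace r43
    have P := blochVector_polygon e3
    have Q := blochVector_polygon (e4.trans (neg_neg _).symm)
    rw [n1, n2, norm_blochVector_diagonal _ h₃] at P
    rw [← n3, ← n5, ← n6, blochVector_neg, norm_neg, norm_blochVector_diagonal _ h₄] at Q
    have t1 := congrArg (fun M => (Matrix.trace M).re) e1
    have t2 := congrArg (fun M => (Matrix.trace M).re) e2
    have t3 := congrArg (fun M => (Matrix.trace M).re) e3
    have t4 := congrArg (fun M => (Matrix.trace M).re) e4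
    have t5 := congrArg (fun M => (Matrix.trace M).re) e5
    have t6 := congrArg (fun M => (Matrix.trace M).re) e6
    simp only [Matrix.trace_add, Matrix.trace_neg, Matrix.trace_diagonal, Fin.sum_univ_two,
      Complex.add_re, Complex.neg_re, Complex.ofReal_re] at t1 t2 t3 t4 t5 t6
    rw [Matrix.trace_mul_comm] at t1 t2 t5 t6
    rw [Matrix.trace_mul_comm r43ᴴ] at t4
    have p1 := norm_blochVector_le_trace r13
    have p2 := norm_blochVector_le_trace r23
    have p5 := norm_blochVector_le_trace r45
    have p6 := norm_blochVector_le_trace r46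
    rw [norm_blochVector_mul_conjTranspose, Matrix.trace_mul_comm] at p5 p6
    have hn := norm_nonneg (blochVector (r43 * r43ᴴ))
    obtain ⟨P1, P2, P3, P4⟩ := P
    obtain ⟨Q1, Q2, Q3, Q4⟩ := Q
    refine ⟨?_, ?_, ?_, ?_, ?_, ?_, ?_, ?_, ?_, ?_, ?_, ?_, ?_, ?_, ?_, ?_, ?_, ?_⟩ <;> linarith
  · rintro ⟨h0, p1, p2, p5, p6, i1, i2, i3, i4, i5, i6, i7, i8, i9, i10, i11, i12, i13⟩
    obtain ⟨c, d, hd, hcd, hT, P1, P2, P3, P4, Q1, Q2, Q3, Q4⟩ : ∃ c d : ℝ, 0 ≤ d ∧ d ≤ c ∧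
        c + d = -(a₁ 0 + a₁ 1 + a₂ 0 + a₂ 1 + a₃ 0 + a₃ 1) ∧
        a₁ 0 - a₁ 1 ≤ (a₂ 0 - a₂ 1) + (c - d) + (a₃ 0 - a₃ 1) ∧
        a₂ 0 - a₂ 1 ≤ (a₁ 0 - a₁ 1) + (c - d) + (a₃ 0 - a₃ 1) ∧
        c - d ≤ (a₁ 0 - a₁ 1) + (a₂ 0 - a₂ 1) + (a₃ 0 - a₃ 1) ∧
        a₃ 0 - a₃ 1 ≤ (a₁ 0 - a₁ 1) + (a₂ 0 - a₂ 1) + (c - d) ∧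
        a₅ 0 - a₅ 1 ≤ (a₆ 0 - a₆ 1) + (c - d) + (a₄ 0 - a₄ 1) ∧
        a₆ 0 - a₆ 1 ≤ (a₅ 0 - a₅ 1) + (c - d) + (a₄ 0 - a₄ 1) ∧
        c - d ≤ (a₅ 0 - a₅ 1) + (a₆ 0 - a₆ 1) + (a₄ 0 - a₄ 1) ∧
        a₄ 0 - a₄ 1 ≤ (a₅ 0 - a₅ 1) + (a₆ 0 - a₆ 1) + (c - d) := by
      obtain ⟨T, hT⟩ : ∃ T, T = -(a₁ 0 + a₁ 1 + a₂ 0 + a₂ 1 + a₃ 0 + a₃ 1) := ⟨_, rfl⟩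
      obtain ⟨δ, hδ⟩ : ∃ δ, δ = min T (min ((a₁ 0 - a₁ 1) + (a₂ 0 - a₂ 1) + (a₃ 0 - a₃ 1))
        ((a₅ 0 - a₅ 1) + (a₆ 0 - a₆ 1) + (a₄ 0 - a₄ 1))) := ⟨_, rfl⟩
      have u1 : δ ≤ T := hδ.trans_le (min_le_left _ _)
      have u2 := hδ.trans_le ((min_le_right _ _).trans (min_le_left _ _))
      have u3 := hδ.trans_le ((min_le_right _ _).trans (min_le_right _ _))
      refine ⟨(T + δ) / 2, (T - δ) / 2, by linarith, ?_, by linarith, ?_, ?_, by linarith, ?_, ?_,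
        ?_, by linarith, ?_⟩
      all_goals
        rw [← sub_nonneg]
        clear u1 u2 u3
        rcases min_choice T (min ((a₁ 0 - a₁ 1) + (a₂ 0 - a₂ 1) + (a₃ 0 - a₃ 1))
          ((a₅ 0 - a₅ 1) + (a₆ 0 - a₆ 1) + (a₄ 0 - a₄ 1))) with hm | hm
        · rw [hm] at hδ
          linarith
        · rw [hm] at hδ
          rcases min_choice ((a₁ 0 - a₁ 1) + (a₂ 0 - a₂ 1) + (a₃ 0 - a₃ 1))
            ((a₅ 0 - a₅ 1) + (a₆ 0 - a₆ 1) + (a₄ 0 - a₄ 1)) with hm' | hm'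
          all_goals
            rw [hm'] at hδ
            linarith
    obtain ⟨x, y, z, hx, hy, hz, hxyz⟩ := exists_quadrilateral (sub_nonneg.2 h₁)
      (sub_nonneg.2 h₂) (sub_nonneg.2 hcd) (sub_nonneg.2 h₃) P1 P2 P3 P4
    obtain ⟨x', y', z', hx', hy', hz', hxyz'⟩ := exists_quadrilateral (sub_nonneg.2 h₅)
      (sub_nonneg.2 h₆) (sub_nonneg.2 hcd) (sub_nonneg.2 h₄) Q1 Q2 Q3 Q4
    obtain ⟨r13, e1, f1⟩ := exists_singular_decomposition (p1.trans h₁) p1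
      ((norm_neg x).trans hx) norm_one
    obtain ⟨r23, e2, f2⟩ := exists_singular_decomposition (p2.trans h₂) p2
      ((norm_neg y).trans hy) norm_one
    obtain ⟨r43, e3, f3⟩ := exists_singular_decomposition (hd.trans hcd) hd
      ((norm_neg z).trans hz) hz'
    obtain ⟨r45, e5, f5⟩ := exists_singular_decomposition (neg_nonneg.2 p5)
      (neg_nonneg.2 (h₅.trans p5)) norm_one ((norm_neg x').trans hx')
    obtain ⟨r46, e6, f6⟩ := exists_singular_decomposition (neg_nonneg.2 p6)
      (neg_nonneg.2 (h₆.trans p6)) norm_one ((norm_neg y').trans hy')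
    refine ⟨r13, r23, r43, r45, r46, ?_, ?_, ?_, ?_, ?_, ?_⟩
    · rw [f1, mul_one, diagonal_eq_symMatrix]
    · rw [f2, mul_one, diagonal_eq_symMatrix]
    · rw [e1, e2, e3, neg_diagonal_eq_symMatrix, symMatrix_add, symMatrix_add]
      congr 1
      · linarith
      · push_cast at hxyz ⊢
        linear_combination (-1 / 2 : ℂ) * hxyz
    · rw [f3, f5, f6, diagonal_eq_symMatrix, symMatrix_add, symMatrix_add]
      congr 2
      · linarith
      · push_cast at hxyz' ⊢
        linear_combination (1 / 2 : ℂ) * hxyz'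
    · rw [e5, mul_one, neg_diagonal_eq_symMatrix]
    · rw [e6, mul_one, neg_diagonal_eq_symMatrix]
end

section
/- Consider the quiver Q_{3,3} with E_x = ℂ² for all six vertices. For every representation r = (r_{13}, r_{23}, r_{43}, r_{45}, r_{46}) of Q_{3,3} on these spaces, there exist one-dimensional subspaces S_1,…,S_6 with S_x ⊆ ℂ² such that S_4 = ℂ e_1 and r_a S_x ⊆ S_y for every arrow a:x→y (i.e. r_{13} S_1 ⊆ S_3, r_{23} S_2 ⊆ S_3, r_{43} S_4 ⊆ S_3, r_{45} S_4 ⊆ S_5, r_{46} S_4 ⊆ S_6). Equivalently, the family [{2},{2},{2},{1},{2},{2}] is Q_{3,3}-intersecting for the dimension vector [2,2,2,2,2,2]. -/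
open Matrix

/-- In a nontrivial vector space, every vector lies in a line. -/
theorem exists_ne_zero_mem_span_singleton {K V : Type*} [DivisionRing K] [AddCommGroup V]
    [Module K V] [Nontrivial V] (v : V) : ∃ w : V, w ≠ 0 ∧ v ∈ Submodule.span K {w} := by
  by_cases hv : v = 0
  · obtain ⟨w, hw⟩ := exists_ne (0 : V)
    exact ⟨w, hw, hv ▸ Submodule.zero_mem _⟩
  · exact ⟨v, hv, Submodule.mem_span_singleton_self v⟩

/-- An endomorphism of a finite-dimensional space maps some line into any given line. -/
theorem LinearMap.exists_ne_zero_apply_mem_span_singleton {K V : Type*} [DivisionRing K]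
    [AddCommGroup V] [Module K V] [FiniteDimensional K V] (f : V →ₗ[K] V) {w : V} (hw : w ≠ 0) :
    ∃ u : V, u ≠ 0 ∧ f u ∈ Submodule.span K {w} := by
  by_cases hf : Function.Injective f
  · obtain ⟨u, rfl⟩ := LinearMap.injective_iff_surjective.mp hf w
    exact ⟨u, fun hu => hw (by rw [hu, map_zero]), Submodule.mem_span_singleton_self _⟩
  · rw [injective_iff_map_eq_zero] at hf
    push Not at hf
    obtain ⟨u, hu, hne⟩ := hf
    exact ⟨u, hne, hu ▸ Submodule.zero_mem _⟩

/-- the family `[{2},{2},{2},{1},{2},{2}]` is `Q_{3,3}`-intersecting for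
`[2,2,2,2,2,2]`: every representation has a subrepresentation by lines with `S₄ = ℂe₁`. -/
theorem q33_intersecting_222 :
    ∀ r13 r23 r43 r45 r46 : (Fin 2 → ℂ) →ₗ[ℂ] (Fin 2 → ℂ),
      ∃ S₁ S₂ S₃ S₄ S₅ S₆ : Submodule ℂ (Fin 2 → ℂ),
        Module.finrank ℂ S₁ = 1 ∧ Module.finrank ℂ S₂ = 1 ∧ Module.finrank ℂ S₃ = 1 ∧
        Module.finrank ℂ S₄ = 1 ∧ Module.finrank ℂ S₅ = 1 ∧ Module.finrank ℂ S₆ = 1 ∧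
        S₄ = Submodule.span ℂ {Pi.single (0 : Fin 2) (1 : ℂ)} ∧
        S₁.map r13 ≤ S₃ ∧ S₂.map r23 ≤ S₃ ∧ S₄.map r43 ≤ S₃ ∧
        S₄.map r45 ≤ S₅ ∧ S₄.map r46 ≤ S₆ := by
  intro r13 r23 r43 r45 r46
  set e : Fin 2 → ℂ := Pi.single (0 : Fin 2) (1 : ℂ) with he
  have he0 : e ≠ 0 := by simp [he]
  obtain ⟨w₃, hw₃, h43⟩ := exists_ne_zero_mem_span_singleton (K := ℂ) (r43 e)
  obtain ⟨w₅, hw₅, h45⟩ := exists_ne_zero_mem_span_singleton (K := ℂ) (r45 e)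
  obtain ⟨w₆, hw₆, h46⟩ := exists_ne_zero_mem_span_singleton (K := ℂ) (r46 e)
  obtain ⟨w₁, hw₁, h13⟩ := r13.exists_ne_zero_apply_mem_span_singleton hw₃
  obtain ⟨w₂, hw₂, h23⟩ := r23.exists_ne_zero_apply_mem_span_singleton hw₃
  have map_le {f : (Fin 2 → ℂ) →ₗ[ℂ] (Fin 2 → ℂ)} {u w : Fin 2 → ℂ}
      (h : f u ∈ Submodule.span ℂ {w}) :
      (Submodule.span ℂ {u}).map f ≤ Submodule.span ℂ {w} := by
    rwa [Submodule.map_span, Set.image_singleton, Submodule.span_singleton_le_iff_mem]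
  exact ⟨.span ℂ {w₁}, .span ℂ {w₂}, .span ℂ {w₃}, .span ℂ {e}, .span ℂ {w₅}, .span ℂ {w₆},
    finrank_span_singleton hw₁, finrank_span_singleton hw₂, finrank_span_singleton hw₃,
    finrank_span_singleton he0, finrank_span_singleton hw₅, finrank_span_singleton hw₆,
    rfl, map_le h13, map_le h23, map_le h43, map_le h45, map_le h46⟩
end

section
/- Consider the quiver Q_{3,3} with E_x = ℂ³ for all six vertices. For every representation r = (r_{13}, r_{23}, r_{43}, r_{45}, r_{46}) of Q_{3,3} on these spaces, there exist two-dimensional subspaces S_1,…,S_6 with S_x ⊆ ℂ³ such that e_1 ∈ S_1, e_1 ∈ S_4, and r_a S_x ⊆ S_y for every arrow a:x→y. Equivalently, the family [{1,3},{2,3},{2,3},{1,3},{2,3},{2,3}] is Q_{3,3}-intersecting for the dimension vector [3,3,3,3,3,3]. -/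
open Matrix

/-- Subspaces of every intermediate dimension can be interpolated in an inclusion `W ≤ U`. -/
theorem Submodule.exists_finrank_eq_between {K V : Type*} [Field K] [AddCommGroup V] [Module K V]
    [FiniteDimensional K V] {W U : Submodule K V} (hWU : W ≤ U) {k : ℕ}
    (hW : Module.finrank K W ≤ k) (hU : k ≤ Module.finrank K U) :
    ∃ S : Submodule K V, W ≤ S ∧ S ≤ U ∧ Module.finrank K S = k := by
  induction k, hW using Nat.le_induction with
  | base => exact ⟨W, le_rfl, hWU, rfl⟩
  | succ k hk ih =>
    obtain ⟨S, hWS, hSU, hS⟩ := ih (by omega)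
    have hlt : S < U := lt_of_le_of_ne hSU (by rintro rfl; omega)
    obtain ⟨x, hxU, hxS⟩ := SetLike.exists_of_lt hlt
    have hle : S ⊔ K ∙ x ≤ U := sup_le hSU (by simpa using hxU)
    have hx := Submodule.finrank_sup_span_singleton hxS
    exact ⟨S ⊔ K ∙ x, hWS.trans le_sup_left, hle, by omega⟩

/-- The codimension of a preimage is at most the codimension of the subspace. -/
theorem Submodule.finrank_add_finrank_le_finrank_comap_add {K V V' : Type*} [Field K]
    [AddCommGroup V] [Module K V] [FiniteDimensional K V] [AddCommGroup V'] [Module K V']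
    [FiniteDimensional K V'] (f : V →ₗ[K] V') (S : Submodule K V') :
    Module.finrank K V + Module.finrank K S ≤
      Module.finrank K (S.comap f) + Module.finrank K V' := by
  have h1 := LinearMap.finrank_range_add_finrank_ker (S.mkQ.comp f)
  rw [LinearMap.ker_comp, Submodule.ker_mkQ] at h1
  have h2 := Submodule.finrank_le (S.mkQ.comp f).range
  have h3 := Submodule.finrank_quotient_add_finrank S
  omega

/-- the family `[{1,3},{2,3},{2,3},{1,3},{2,3},{2,3}]` is
`Q_{3,3}`-intersecting for `[3,3,3,3,3,3]`: every representation has a subrepresentation by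
planes with `e₁ ∈ S₁` and `e₁ ∈ S₄`. -/
theorem q33_intersecting_333 :
    ∀ r13 r23 r43 r45 r46 : (Fin 3 → ℂ) →ₗ[ℂ] (Fin 3 → ℂ),
      ∃ S₁ S₂ S₃ S₄ S₅ S₆ : Submodule ℂ (Fin 3 → ℂ),
        Module.finrank ℂ S₁ = 2 ∧ Module.finrank ℂ S₂ = 2 ∧ Module.finrank ℂ S₃ = 2 ∧
        Module.finrank ℂ S₄ = 2 ∧ Module.finrank ℂ S₅ = 2 ∧ Module.finrank ℂ S₆ = 2 ∧
        Pi.single (0 : Fin 3) (1 : ℂ) ∈ S₁ ∧ Pi.single (0 : Fin 3) (1 : ℂ) ∈ S₄ ∧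
        S₁.map r13 ≤ S₃ ∧ S₂.map r23 ≤ S₃ ∧ S₄.map r43 ≤ S₃ ∧
        S₄.map r45 ≤ S₅ ∧ S₄.map r46 ≤ S₆ := by
  intro r13 r23 r43 r45 r46
  set e : Fin 3 → ℂ := Pi.single 0 1
  have extend (W : Submodule ℂ (Fin 3 → ℂ)) (hW : Module.finrank ℂ W ≤ 2) :
      ∃ S : Submodule ℂ (Fin 3 → ℂ), W ≤ S ∧ Module.finrank ℂ S = 2 := by
    obtain ⟨S, hWS, -, hS⟩ :=
      Submodule.exists_finrank_eq_between (le_top : W ≤ ⊤) hW (by simp)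
    exact ⟨S, hWS, hS⟩
  have pullback (r : (Fin 3 → ℂ) →ₗ[ℂ] (Fin 3 → ℂ)) (v : Fin 3 → ℂ)
      (T : Submodule ℂ (Fin 3 → ℂ)) (hT : Module.finrank ℂ T = 2) (hv : r v ∈ T) :
      ∃ S : Submodule ℂ (Fin 3 → ℂ), v ∈ S ∧ S.map r ≤ T ∧ Module.finrank ℂ S = 2 := by
    have hU := Submodule.finrank_add_finrank_le_finrank_comap_add r T
    obtain ⟨S, hvS, hST, hS⟩ := Submodule.exists_finrank_eq_between (k := 2)
      (show ℂ ∙ v ≤ T.comap r by simpa using hv)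
      ((finrank_span_le_card {v}).trans (by simp)) (by omega)
    exact ⟨S, by simpa using hvS, Submodule.map_le_iff_le_comap.2 hST, hS⟩
  obtain ⟨S₃, h3, d3⟩ := extend (Submodule.span ℂ {r13 e, r43 e}) <| by
    classical
    have h := (finrank_span_finset_le_card (R := ℂ) {r13 e, r43 e}).trans Finset.card_le_two
    rwa [Set.finrank, Finset.coe_pair] at h
  rw [Submodule.span_le, Set.pair_subset_iff] at h3
  obtain ⟨S₁, e1, m1, d1⟩ := pullback r13 e S₃ d3 h3.1
  obtain ⟨S₂, -, m2, d2⟩ := pullback r23 0 S₃ d3 (by simp)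
  obtain ⟨S₄, e4, m4, d4⟩ := pullback r43 e S₃ d3 h3.2
  obtain ⟨S₅, m5, d5⟩ := extend (S₄.map r45) ((Submodule.finrank_map_le r45 S₄).trans d4.le)
  obtain ⟨S₆, m6, d6⟩ := extend (S₄.map r46) ((Submodule.finrank_map_le r46 S₄).trans d4.le)
  exact ⟨S₁, S₂, S₃, S₄, S₅, S₆, d1, d2, d3, d4, d5, d6, e1, e4, m1, m2, m4, m5, m6⟩
end
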